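/- arXiv:2203.06623 — 2 statements merged into one kernel-verified Lean document; each statement's English description precedes it below -/
import Mathlib

section
/- Let α > 0, let γ satisfy 0 < γ < min(1, α), let μ > 0, and let φ be a radial function with |φ(|t|_p)| ≤ μ |t|_p^{−γ} for all t ≠ 0. Then for every t ≠ 0 the integral defining (I^α φ)(t) converges absolutely, (I^α φ)(t) depends only on |t|_p, and there exists a constant C_0 > 0, depending only on p, α and γ (not on φ, μ or t), such that |(I^α φ)(|t|_p)| ≤ C_0 μ |t|_p^{α−γ} for all t ≠ 0. -/
open MeasureTheory Metric

noncomputable section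

variable (p : ℕ) [Fact p.Prime]

instance : MeasurableSpace ℚ_[p] := borel _
instance : BorelSpace ℚ_[p] := ⟨rfl⟩

/-- The closed unit ball of `ℚ_[p]` as a positive compact set. -/
def unitBallPC : TopologicalSpace.PositiveCompacts ℚ_[p] where
  carrier := closedBall 0 1
  isCompact' := isCompact_closedBall 0 1
  interior_nonempty' := ⟨0, mem_interior_iff_mem_nhds.2
    (Filter.mem_of_superset (ball_mem_nhds 0 one_pos) ball_subset_closedBall)⟩

/-- The Haar measure on `ℚ_[p]` normalized so the unit ball has measure 1. -/
def padicHaar : Measure ℚ_[p] := Measure.addHaarMeasure (unitBallPC p)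

/-- A point on the sphere of radius `p^k`. -/
def sph (k : ℤ) : ℚ_[p] := (p : ℚ_[p]) ^ (-k)

/-- A function is radial if it depends only on the p-adic absolute value. -/
def Radial (u : ℚ_[p] → ℝ) : Prop := ∀ x y : ℚ_[p], ‖x‖ = ‖y‖ → u x = u y

/-- The integrand of the Vladimirov operator `D^α` at `x`. -/
def Dker (α : ℝ) (u : ℚ_[p] → ℝ) (x : ℚ_[p]) : ℚ_[p] → ℝ :=
  fun y => ‖y‖ ^ (-α - 1) * (u (x - y) - u x)

/-- The Vladimirov fractional differentiation operator. -/
def Dop (α : ℝ) (u : ℚ_[p] → ℝ) (x : ℚ_[p]) : ℝ :=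
  ((1 - (p : ℝ) ^ α) / (1 - (p : ℝ) ^ (-α - 1))) * ∫ y, Dker p α u x y ∂(padicHaar p)

/-- The kernel of the fractional integral `I^α`. -/
def Iker (α : ℝ) (x y : ℚ_[p]) : ℝ :=
  if α = 1 then Real.log ‖x - y‖ - Real.log ‖y‖
  else ‖x - y‖ ^ (α - 1) - ‖y‖ ^ (α - 1)

/-- The constant in front of the fractional integral. -/
def Icoef (α : ℝ) : ℝ :=
  if α = 1 then (1 - (p : ℝ)) / (p * Real.log p)
  else (1 - (p : ℝ) ^ (-α)) / (1 - (p : ℝ) ^ (α - 1))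

/-- The p-adic fractional integral `I^α`. -/
def Iop (α : ℝ) (u : ℚ_[p] → ℝ) (x : ℚ_[p]) : ℝ :=
  Icoef p α * ∫ y in {y : ℚ_[p] | ‖y‖ ≤ ‖x‖}, Iker p α x y * u y ∂(padicHaar p)

end


section helpers

variable {p : ℕ} [Fact p.Prime]

instance : (padicHaar p).IsAddHaarMeasure := by unfold padicHaar; infer_instance

lemma padicHaar_unit : padicHaar p (closedBall 0 1) = 1 :=
  Measure.addHaarMeasure_self (K₀ := unitBallPC p)

lemma pgt : (1:ℝ) < p := by exact_mod_cast (Fact.out : p.Prime).one_lt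

lemma measurable_radial {φ : ℚ_[p] → ℝ} (h : Radial p φ) : Measurable φ := by
  intro s _
  have hc : (Set.range (fun x : ℚ_[p] => ‖x‖)).Countable := by
    refine (Set.countable_range (fun q : ℚ => (q:ℝ))).mono ?_
    rintro _ ⟨x, rfl⟩
    obtain ⟨q, hq⟩ := Padic.padicNormE.is_rat x
    exact ⟨q, hq.symm⟩
  have : φ ⁻¹' s = (fun x : ℚ_[p] => ‖x‖) ⁻¹' ((fun x : ℚ_[p] => ‖x‖) '' (φ ⁻¹' s)) := by
    ext x
    constructor
    · intro hx; exact ⟨x, hx, rfl⟩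
    · rintro ⟨y, hy, hxy⟩
      have := h y x hxy
      simpa [this] using hy
  rw [this]
  exact measurable_norm ((hc.mono (Set.image_subset_range _ _)).measurableSet)

lemma map_mul_haar (c : ℚ_[p]) (hc : c ≠ 0) :
    (padicHaar p).map (fun x => c * x) = padicHaar p (closedBall 0 (‖c‖⁻¹)) • padicHaar p := by
  have hH : ((padicHaar p).map (fun x => c * x)).IsAddHaarMeasure :=
    AddEquiv.isAddHaarMeasure_map (padicHaar p)
      (DistribMulAction.toAddEquiv₀ ℚ_[p] c hc) (continuous_const.mul continuous_id)
      (continuous_const.mul continuous_id)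
  have := Measure.addHaarMeasure_unique ((padicHaar p).map (fun x => c * x)) (unitBallPC p)
  rw [this]
  change _ • padicHaar p = _
  congr 1
  rw [Measure.map_apply (by fun_prop) (unitBallPC p).isCompact.measurableSet]
  congr 1
  ext x
  have : 0 < ‖c‖ := norm_pos_iff.2 hc
  change c * x ∈ closedBall 0 1 ↔ _
  simp only [mem_closedBall_zero_iff, norm_mul]
  rw [← one_div, le_div_iff₀ this, mul_comm]

lemma pball_mul (c : ℚ_[p]) (hc : c ≠ 0) (r : ℝ) :
    padicHaar p (closedBall 0 (r * ‖c‖⁻¹))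
      = padicHaar p (closedBall 0 (‖c‖⁻¹)) * padicHaar p (closedBall 0 r) := by
  have := congrArg (fun m => m (closedBall 0 r)) (map_mul_haar c hc)
  simp only [Measure.smul_apply, smul_eq_mul] at this
  rw [← this, Measure.map_apply (by fun_prop) measurableSet_closedBall]
  congr 1
  ext x
  have : 0 < ‖c‖ := norm_pos_iff.2 hc
  simp only [mem_closedBall_zero_iff, norm_mul, Set.mem_preimage]
  rw [← div_eq_mul_inv, le_div_iff₀ this, mul_comm]

lemma ball_inv_p : (p : ENNReal) * padicHaar p (closedBall 0 ((p:ℝ)⁻¹)) = 1 := by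
  have hp0 : (0:ℝ) < p := by linarith [pgt (p := p)]
  have hlt : ∀ x : ℚ_[p], ‖x‖ ≤ (p:ℝ)⁻¹ ↔ ‖x‖ < 1 := by
    intro x
    have := Padic.norm_le_pow_iff_norm_lt_pow_add_one x (-1)
    simpa using this
  have hU : closedBall (0:ℚ_[p]) 1 = ⋃ i ∈ Finset.range p, closedBall (i:ℚ_[p]) ((p:ℝ)⁻¹) := by
    ext x
    rw [mem_closedBall_zero_iff]
    simp only [Set.mem_iUnion, mem_closedBall, dist_eq_norm, hlt,
      Finset.mem_range, exists_prop]
    constructor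
    · intro hx
      refine ⟨PadicInt.zmodRepr ⟨x, hx⟩, PadicInt.zmodRepr_lt_p _, ?_⟩
      exact PadicInt.norm_sub_zmodRepr_lt_one ⟨x, hx⟩
    · rintro ⟨i, _, hi⟩
      have h1 : ‖(i:ℚ_[p])‖ ≤ 1 := by
        simpa using Padic.norm_int_le_one (p := p) (i:ℤ)
      have := Padic.nonarchimedean (x - (i:ℚ_[p])) i
      rw [sub_add_cancel] at this
      exact this.trans (max_le hi.le h1)
  have hd : (Finset.range p : Set ℕ).PairwiseDisjoint
      (fun i : ℕ => closedBall (i:ℚ_[p]) ((p:ℝ)⁻¹)) := by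
    intro i hi j hj hij
    rw [Function.onFun, Set.disjoint_left]
    intro x hxi hxj
    simp only [mem_closedBall, dist_eq_norm, hlt] at hxi hxj
    apply hij
    have hn : ‖((i:ℤ) - (j:ℤ) : ℤ) |> fun z : ℤ => (z : ℚ_[p])‖ < 1 := by
      have := Padic.nonarchimedean (x - (j:ℚ_[p])) (-(x - (i:ℚ_[p])))
      rw [norm_neg] at this
      refine lt_of_le_of_lt (le_trans (le_of_eq ?_) this) (max_lt hxj hxi)
      congr 1; push_cast; ring
    replace hn := Padic.norm_intCast_lt_one_iff.1 hn
    have hi' : i < p := by simpa using hi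
    have hj' : j < p := by simpa using hj
    have := Int.eq_zero_of_abs_lt_dvd hn (by rw [abs_lt]; omega)
    omega
  have := padicHaar_unit (p := p)
  rw [hU, measure_biUnion_finset hd (fun _ _ => measurableSet_closedBall)] at this
  rw [← this]
  have he : ∀ i : ℕ, padicHaar p (closedBall (i:ℚ_[p]) ((p:ℝ)⁻¹))
      = padicHaar p (closedBall 0 ((p:ℝ)⁻¹)) := fun i => by
    rw [Measure.addHaar_closedBall_center]
  simp [he]

lemma ball_pow (n : ℕ) : padicHaar p (closedBall 0 (((p:ℝ)⁻¹)^n)) = ((p:ENNReal)⁻¹)^n := by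
  have hp0 : (p:ENNReal) ≠ 0 := by simp [(Fact.out : p.Prime).ne_zero]
  have h1 : padicHaar p (closedBall 0 ((p:ℝ)⁻¹)) = (p:ENNReal)⁻¹ :=
    ENNReal.eq_inv_of_mul_eq_one_left (by rw [mul_comm]; exact ball_inv_p)
  induction n with
  | zero => simp [padicHaar_unit]
  | succ n ih =>
    have hp : ((p:ℚ_[p])⁻¹) ≠ 0 := by simp [(Fact.out : p.Prime).ne_zero]
    have := pball_mul ((p:ℚ_[p])⁻¹) hp (((p:ℝ)⁻¹)^n)
    simp only [norm_inv, Padic.norm_p, inv_inv] at this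
    rw [pow_succ, this, h1, ih, pow_succ, mul_comm]

lemma ball_norm (c : ℚ_[p]) (hc : c ≠ 0) :
    padicHaar p (closedBall 0 ‖c‖) = ENNReal.ofReal ‖c‖ := by
  have hp0 : (0:ℝ) < p := by linarith [pgt (p := p)]
  have small : ∀ c : ℚ_[p], c ≠ 0 → ‖c‖ ≤ 1 →
      padicHaar p (closedBall 0 ‖c‖) = ENNReal.ofReal ‖c‖ := by
    intro c hc h1
    obtain ⟨n, hn⟩ : ∃ n : ℕ, ‖c‖ = ((p:ℝ)⁻¹)^n := by
      have h := Padic.norm_eq_zpow_neg_valuation hc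
      have hv : 0 ≤ c.valuation := by rwa [← Padic.norm_le_one_iff_val_nonneg]
      refine ⟨c.valuation.toNat, ?_⟩
      rw [h, ← zpow_natCast, Int.toNat_of_nonneg hv, zpow_neg, inv_zpow]
    rw [hn, ball_pow, ENNReal.ofReal_pow (by positivity), ENNReal.ofReal_inv_of_pos hp0]
    simp
  rcases le_total ‖c‖ 1 with h | h
  · exact small c hc h
  · have hpos : 0 < ‖c‖ := norm_pos_iff.2 hc
    have h' := small c⁻¹ (inv_ne_zero hc) (by rw [norm_inv]; exact inv_le_one_of_one_le₀ h)
    have h2 := pball_mul c hc ‖c‖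
    rw [mul_inv_cancel₀ hpos.ne', padicHaar_unit, ← norm_inv, h', norm_inv,
      ENNReal.ofReal_inv_of_pos hpos] at h2
    have := ENNReal.eq_inv_of_mul_eq_one_left ((mul_comm _ _).trans h2.symm)
    rwa [inv_inv] at this

lemma map_mul_haar' (c : ℚ_[p]) (hc : c ≠ 0) :
    (padicHaar p).map (fun x => c * x) = ENNReal.ofReal (‖c‖⁻¹) • padicHaar p := by
  rw [map_mul_haar c hc, ← norm_inv, ball_norm _ (inv_ne_zero hc)]


lemma membed (c : ℚ_[p]) (hc : c ≠ 0) : MeasurableEmbedding (fun x : ℚ_[p] => c * x) :=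
  (Homeomorph.mulLeft₀ c hc).measurableEmbedding

lemma integrable_scale (c : ℚ_[p]) (hc : c ≠ 0) (F : ℚ_[p] → ℝ) :
    Integrable (fun z => F (c * z)) (padicHaar p) ↔ Integrable F (padicHaar p) := by
  have h := (membed c hc).integrable_map_iff (μ := padicHaar p) (g := F)
  rw [map_mul_haar' c hc, integrable_smul_measure (by simpa using hc) (by simp)] at h
  exact h.symm

lemma integral_scale (c : ℚ_[p]) (hc : c ≠ 0) (F : ℚ_[p] → ℝ) :
    ∫ z, F (c * z) ∂(padicHaar p) = ‖c‖⁻¹ * ∫ z, F z ∂(padicHaar p) := by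
  have h := (membed c hc).integral_map (μ := padicHaar p) F
  rw [map_mul_haar' c hc, integral_smul_measure] at h
  rw [← h]
  simp

lemma integrableOn_norm_rpow (s : ℝ) (hs : -1 < s) :
    IntegrableOn (fun z : ℚ_[p] => ‖z‖ ^ s) (closedBall 0 1) (padicHaar p) := by
  have hp1 := pgt (p := p)
  have hp0 : (0:ℝ) < p := by linarith
  set q : ℝ := (p:ℝ)⁻¹ with hq
  have hq0 : 0 < q := by positivity
  have hq1 : q < 1 := inv_lt_one_of_one_lt₀ hp1
  refine ⟨(by fun_prop : Measurable fun z : ℚ_[p] => ‖z‖ ^ s).aestronglyMeasurable, ?_⟩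
  have hsub : closedBall (0:ℚ_[p]) 1 ⊆ {0} ∪ ⋃ n : ℕ, {z : ℚ_[p] | ‖z‖ = q ^ n} := by
    intro c h1
    rw [mem_closedBall_zero_iff] at h1
    by_cases hc : c = 0
    · left; exact hc
    right
    have h := Padic.norm_eq_zpow_neg_valuation hc
    have hv : 0 ≤ c.valuation := by rwa [← Padic.norm_le_one_iff_val_nonneg]
    refine Set.mem_iUnion.2 ⟨c.valuation.toNat, ?_⟩
    rw [Set.mem_setOf_eq, h, ← zpow_natCast, Int.toNat_of_nonneg hv, zpow_neg, hq, inv_zpow]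
  rw [HasFiniteIntegral]
  refine lt_of_le_of_lt (lintegral_mono_set hsub) ?_
  refine lt_of_le_of_lt (lintegral_union_le _ _ _) ?_
  rw [Measure.restrict_singleton]
  simp only [measure_singleton, zero_smul, lintegral_zero_measure, zero_add]
  refine lt_of_le_of_lt (lintegral_iUnion_le _ _) ?_
  have hterm : ∀ n : ℕ, ∫⁻ z in {z : ℚ_[p] | ‖z‖ = q ^ n}, ‖‖z‖ ^ s‖ₑ ∂(padicHaar p)
      ≤ ENNReal.ofReal ((q ^ (s + 1)) ^ n) := by
    intro n
    have hm : MeasurableSet {z : ℚ_[p] | ‖z‖ = q ^ n} :=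
      measurableSet_eq_fun measurable_norm measurable_const
    calc ∫⁻ z in {z : ℚ_[p] | ‖z‖ = q ^ n}, ‖‖z‖ ^ s‖ₑ ∂(padicHaar p)
        = ∫⁻ z in {z : ℚ_[p] | ‖z‖ = q ^ n}, ENNReal.ofReal ((q ^ n) ^ s) ∂(padicHaar p) := by
          refine setLIntegral_congr_fun hm ?_
          intro z hz
          have hz' : ‖z‖ = q ^ n := hz
          simp only [hz']
          rw [Real.enorm_eq_ofReal (by positivity)]
      _ = ENNReal.ofReal ((q ^ n) ^ s) * padicHaar p {z : ℚ_[p] | ‖z‖ = q ^ n} := by simp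
      _ ≤ ENNReal.ofReal ((q ^ n) ^ s) * padicHaar p (closedBall 0 (q ^ n)) := by
          gcongr
          intro z hz
          rw [mem_closedBall_zero_iff]
          exact le_of_eq hz
      _ = ENNReal.ofReal ((q ^ (s + 1)) ^ n) := by
          rw [ball_pow]
          have : ((p:ENNReal)⁻¹) ^ n = ENNReal.ofReal (q ^ n) := by
            rw [ENNReal.ofReal_pow hq0.le, hq, ENNReal.ofReal_inv_of_pos hp0]; simp
          rw [this, ← ENNReal.ofReal_mul (by positivity)]
          congr 1
          rw [Real.rpow_add hq0, mul_pow, Real.rpow_one, ← Real.rpow_natCast, ← Real.rpow_natCast,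
            ← Real.rpow_mul hq0.le, ← Real.rpow_mul hq0.le, mul_comm s]
  refine lt_of_le_of_lt (ENNReal.tsum_le_tsum hterm) ?_
  have hr : q ^ (s + 1) < 1 := Real.rpow_lt_one hq0.le hq1 (by linarith)
  have hsum := summable_geometric_of_lt_one (by positivity) hr
  rw [← ENNReal.ofReal_tsum_of_nonneg (fun n => by positivity) hsum]
  exact ENNReal.ofReal_lt_top

lemma integrableOn_norm_one_sub_rpow (s : ℝ) (hs : -1 < s) :
    IntegrableOn (fun z : ℚ_[p] => ‖1 - z‖ ^ s) (closedBall 0 1) (padicHaar p) := by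
  have h := integrableOn_norm_rpow (p := p) s hs
  rw [← integrable_indicator_iff measurableSet_closedBall] at h ⊢
  have h2 := h.comp_sub_left (1 : ℚ_[p])
  refine h2.congr (Filter.Eventually.of_forall fun z => ?_)
  have hB : ∀ z : ℚ_[p], ‖z‖ ≤ 1 → ‖1 - z‖ ≤ 1 := fun z hz => by
    have := Padic.nonarchimedean (1:ℚ_[p]) (-z)
    rw [norm_neg, ← sub_eq_add_neg, norm_one] at this
    exact this.trans (max_le le_rfl hz)
  by_cases hz : ‖z‖ ≤ 1
  · simp only [Set.indicator, mem_closedBall_zero_iff, hz, hB z hz, if_true]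
  · have : ¬ ‖1 - z‖ ≤ 1 := fun h => hz (by simpa using hB _ h)
    simp only [Set.indicator, mem_closedBall_zero_iff, hz, this, if_false]

lemma abs_log_le (t x : ℝ) (ht : 0 < t) (hx0 : 0 ≤ x) (hx : x ≤ 1) :
    |Real.log x| ≤ 1 / t * x ^ (-t) := by
  rcases hx0.eq_or_lt with rfl | h0
  · simp; positivity
  have := (Real.abs_log_mul_self_rpow_lt x t h0 hx ht).le
  rw [abs_mul, abs_of_nonneg (Real.rpow_nonneg h0.le t)] at this
  rw [Real.rpow_neg h0.le, ← div_eq_mul_inv, le_div_iff₀ (Real.rpow_pos_of_pos h0 t)]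
  exact this

lemma measurable_Iker (α : ℝ) (t : ℚ_[p]) : Measurable (Iker p α t) := by
  unfold Iker
  split_ifs <;> fun_prop

lemma norm_one_sub_eq (z : ℚ_[p]) (hz : ‖z‖ < 1) : ‖1 - z‖ = 1 := by
  have := Padic.add_eq_max_of_ne (p := p) (q := 1) (r := -z) (by rw [norm_neg, norm_one]; exact hz.ne')
  rw [norm_neg, norm_one, ← sub_eq_add_neg] at this
  rw [this, max_eq_left hz.le]

lemma integrableOn_G (α γ : ℝ) (hα : 0 < α) (hγ0 : 0 < γ) (hγ : γ < min 1 α) :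
    IntegrableOn (fun z : ℚ_[p] => |Iker p α 1 z| * ‖z‖ ^ (-γ)) (closedBall 0 1)
      (padicHaar p) := by
  have h1 : γ < 1 := hγ.trans_le (min_le_left _ _)
  have h2 : γ < α := hγ.trans_le (min_le_right _ _)
  have hm : AEStronglyMeasurable (fun z : ℚ_[p] => |Iker p α 1 z| * ‖z‖ ^ (-γ))
      ((padicHaar p).restrict (closedBall 0 1)) := by
    have h3 : Measurable fun z : ℚ_[p] => ‖z‖ ^ (-γ) := by fun_prop
    have h4 : Measurable fun z : ℚ_[p] => |Iker p α 1 z| :=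
      continuous_abs.measurable.comp (measurable_Iker α 1)
    exact (h4.mul h3).aestronglyMeasurable
  by_cases ha : α = 1
  · set ε := (1 - γ) / 2 with hε
    have hε0 : 0 < ε := by rw [hε]; linarith
    have hb : IntegrableOn (fun z : ℚ_[p] => 1 / ε * ‖z‖ ^ (-γ - ε) + 1 / ε * ‖1 - z‖ ^ (-ε))
        (closedBall 0 1) (padicHaar p) :=
      Integrable.add ((integrableOn_norm_rpow _ (by rw [hε]; linarith)).const_mul _)
        ((integrableOn_norm_one_sub_rpow _ (by rw [hε]; linarith)).const_mul _)
    refine Integrable.mono' hb hm ?_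
    refine (ae_restrict_iff' measurableSet_closedBall).2 (Filter.Eventually.of_forall fun z hz => ?_)
    rw [mem_closedBall_zero_iff] at hz
    rw [Real.norm_of_nonneg (by positivity)]
    by_cases hz0 : z = 0
    · subst hz0
      rw [norm_zero, Real.zero_rpow (by linarith)]
      rw [mul_zero]; positivity
    have hzp : 0 < ‖z‖ := norm_pos_iff.2 hz0
    simp only [Iker, ha, if_true]
    rcases hz.lt_or_eq with hlt | heq
    · rw [norm_one_sub_eq z hlt, Real.log_one, zero_sub, abs_neg]
      have := abs_log_le ε ‖z‖ hε0 hzp.le hz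
      calc |Real.log ‖z‖| * ‖z‖ ^ (-γ) ≤ (1 / ε * ‖z‖ ^ (-ε)) * ‖z‖ ^ (-γ) := by gcongr
        _ = 1 / ε * ‖z‖ ^ (-γ - ε) := by
          rw [mul_assoc, ← Real.rpow_add hzp]; congr 2; ring
        _ ≤ _ := by
          have : 0 ≤ 1 / ε * (1:ℝ) ^ (-ε) := by positivity
          linarith
    · rw [heq, Real.log_one, sub_zero, Real.one_rpow, mul_one]
      have hle : ‖1 - z‖ ≤ 1 := by
        have := Padic.nonarchimedean (1:ℚ_[p]) (-z)
        rw [norm_neg, ← sub_eq_add_neg, norm_one] at this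
        exact this.trans (max_le le_rfl hz)
      have := abs_log_le ε ‖1 - z‖ hε0 (norm_nonneg _) hle
      have h0 : 0 ≤ 1 / ε * (1:ℝ) ^ (-γ - ε) := by positivity
      linarith
  · have hb : IntegrableOn (fun z : ℚ_[p] => ‖z‖ ^ (-γ) + ‖z‖ ^ (α - 1 - γ) +
        (‖1 - z‖ ^ (α - 1) + ‖z‖ ^ (0:ℝ))) (closedBall 0 1) (padicHaar p) :=
      ((integrableOn_norm_rpow _ (by linarith)).add (integrableOn_norm_rpow _ (by linarith))).add
        ((integrableOn_norm_one_sub_rpow _ (by linarith)).add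
          (integrableOn_norm_rpow _ (by norm_num)))
    refine Integrable.mono' hb hm ?_
    refine (ae_restrict_iff' measurableSet_closedBall).2 (Filter.Eventually.of_forall fun z hz => ?_)
    rw [mem_closedBall_zero_iff] at hz
    rw [Real.norm_of_nonneg (by positivity)]
    by_cases hz0 : z = 0
    · subst hz0
      rw [norm_zero, Real.zero_rpow (x := -γ) (by linarith)]
      rw [mul_zero]; positivity
    have hzp : 0 < ‖z‖ := norm_pos_iff.2 hz0
    simp only [Iker, ha, if_false]
    rcases hz.lt_or_eq with hlt | heq
    · rw [norm_one_sub_eq z hlt, Real.one_rpow, Real.rpow_zero]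
      have h5 : ‖z‖ ^ (α - 1 - γ) = ‖z‖ ^ (α - 1) * ‖z‖ ^ (-γ) := by
        rw [← Real.rpow_add hzp]; congr 1
      have h6 : |1 - ‖z‖ ^ (α - 1)| ≤ 1 + ‖z‖ ^ (α - 1) := by
        have : 0 ≤ ‖z‖ ^ (α - 1) := by positivity
        rw [abs_le]; constructor <;> linarith
      rw [h5]
      have := mul_le_mul_of_nonneg_right h6 (by positivity : 0 ≤ ‖z‖ ^ (-γ))
      linarith
    · rw [heq]
      simp only [Real.one_rpow, mul_one]
      have : 0 ≤ ‖1 - z‖ ^ (α - 1) := by positivity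
      rw [abs_le]; constructor <;> linarith

lemma Iker_scale (α : ℝ) (t z : ℚ_[p]) (ht : t ≠ 0) (hz0 : z ≠ 0) (hz1 : z ≠ 1) :
    Iker p α t (t * z) = ‖t‖ ^ (α - 1) * Iker p α 1 z := by
  have h1 : t - t * z = t * (1 - z) := by ring
  have htp : 0 < ‖t‖ := norm_pos_iff.2 ht
  have hzp : 0 < ‖z‖ := norm_pos_iff.2 hz0
  have hzp1 : 0 < ‖1 - z‖ := norm_pos_iff.2 (sub_ne_zero.2 hz1.symm)
  simp only [Iker, h1, norm_mul]
  split_ifs with ha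
  · rw [ha, sub_self, Real.rpow_zero, Real.log_mul htp.ne' hzp1.ne', Real.log_mul htp.ne' hzp.ne']
    ring
  · rw [Real.mul_rpow htp.le hzp1.le, Real.mul_rpow htp.le hzp.le]
    ring

lemma Iker_unit (α : ℝ) (c t z : ℚ_[p]) (hc : ‖c‖ = 1) :
    Iker p α (c * t) (c * z) = Iker p α t z := by
  have h1 : c * t - c * z = c * (t - z) := by ring
  simp only [Iker, h1, norm_mul, hc, one_mul]

lemma scaled_G (α γ : ℝ) (hα : 0 < α) (hγ0 : 0 < γ) (hγ : γ < min 1 α) (t : ℚ_[p]) (ht : t ≠ 0) :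
    IntegrableOn (fun y : ℚ_[p] => |Iker p α t y| * ‖y‖ ^ (-γ)) (closedBall 0 ‖t‖)
      (padicHaar p) ∧
    ∫ y in closedBall 0 ‖t‖, |Iker p α t y| * ‖y‖ ^ (-γ) ∂(padicHaar p)
      = ‖t‖ ^ (α - γ) *
        ∫ z in closedBall 0 1, |Iker p α 1 z| * ‖z‖ ^ (-γ) ∂(padicHaar p) := by
  have htp : 0 < ‖t‖ := norm_pos_iff.2 ht
  have hG := integrableOn_G (p := p) α γ hα hγ0 hγ
  rw [← integrable_indicator_iff measurableSet_closedBall] at hG ⊢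
  rw [← integral_indicator measurableSet_closedBall, ← integral_indicator measurableSet_closedBall]
  set F := (closedBall (0:ℚ_[p]) ‖t‖).indicator (fun y : ℚ_[p] => |Iker p α t y| * ‖y‖ ^ (-γ))
  set G := (closedBall (0:ℚ_[p]) 1).indicator (fun y : ℚ_[p] => |Iker p α 1 y| * ‖y‖ ^ (-γ))
  have hae : (fun z => ‖t‖ ^ (α - 1 - γ) * G z) =ᵐ[padicHaar p] fun z => F (t * z) := by
    have e0 : ∀ᵐ z ∂(padicHaar p), z ≠ (0:ℚ_[p]) := by simp [ae_iff]
    have e1 : ∀ᵐ z ∂(padicHaar p), z ≠ (1:ℚ_[p]) := by simp [ae_iff]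
    filter_upwards [e0, e1] with z hz0 hz1
    have hiff : ‖t‖ * ‖z‖ ≤ ‖t‖ ↔ ‖z‖ ≤ 1 := mul_le_iff_le_one_right htp
    simp only [F, G, Set.indicator, mem_closedBall_zero_iff, norm_mul, hiff]
    split_ifs with h
    · rw [Iker_scale α t z ht hz0 hz1, abs_mul, abs_of_nonneg (by positivity : 0 ≤ ‖t‖ ^ (α - 1)),
        Real.mul_rpow htp.le (norm_nonneg _), sub_eq_add_neg (α - 1) γ, Real.rpow_add htp]
      ring
    · simp
  have hFi : Integrable F (padicHaar p) :=
    (integrable_scale t ht F).1 ((hG.const_mul _).congr hae)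
  refine ⟨hFi, ?_⟩
  have h := integral_scale t ht F
  rw [← integral_congr_ae hae, integral_const_mul] at h
  have h3 : ‖t‖ ^ (α - γ) = ‖t‖ * ‖t‖ ^ (α - 1 - γ) := by
    rw [← Real.rpow_one_add' htp.le (by linarith [hγ.trans_le (min_le_right _ _)])]
    congr 1; ring
  rw [h3, mul_assoc, h, mul_inv_cancel_left₀ htp.ne']

lemma Iop_radial (α : ℝ) (φ : ℚ_[p] → ℝ) (hφ : Radial p φ) (t t' : ℚ_[p]) (ht : t ≠ 0)
    (h : ‖t'‖ = ‖t‖) : Iop p α φ t' = Iop p α φ t := by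
  have htp : 0 < ‖t‖ := norm_pos_iff.2 ht
  have hc1 : ‖t' / t‖ = 1 := by rw [norm_div, h, div_self htp.ne']
  have hc : t' / t ≠ 0 := norm_pos_iff.1 (by rw [hc1]; norm_num)
  set c := t' / t with hcdef
  have ht' : t' = c * t := by rw [hcdef, div_mul_cancel₀ _ ht]
  have hms : MeasurableSet {y : ℚ_[p] | ‖y‖ ≤ ‖t‖} :=
    measurableSet_le measurable_norm measurable_const
  unfold Iop
  congr 1
  rw [h, ← integral_indicator hms, ← integral_indicator hms]
  have := integral_scale c hc ({y : ℚ_[p] | ‖y‖ ≤ ‖t‖}.indicator fun y => Iker p α t' y * φ y)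
  rw [hc1, inv_one, one_mul] at this
  rw [← this]
  congr 1
  funext z
  have hφz : φ (c * z) = φ z := hφ _ _ (by rw [norm_mul, hc1, one_mul])
  simp only [Set.indicator, Set.mem_setOf_eq, norm_mul, hc1, one_mul, hφz]
  rw [ht', Iker_unit α c t z hc1]

end helpers

/-- bound for `I^α φ` when `|φ(t)| ≤ μ |t|^{-γ}`. -/
theorem Iop_bound_base (p : ℕ) [Fact p.Prime] (α γ : ℝ) (hα : 0 < α) (hγ0 : 0 < γ)
    (hγ : γ < min 1 α) :
    ∃ C₀ : ℝ, 0 < C₀ ∧ ∀ μ' : ℝ, 0 < μ' → ∀ φ : ℚ_[p] → ℝ, Radial p φ →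
      (∀ t : ℚ_[p], t ≠ 0 → |φ t| ≤ μ' * ‖t‖ ^ (-γ)) →
      ∀ t : ℚ_[p], t ≠ 0 →
        IntegrableOn (fun y => Iker p α t y * φ y) {y : ℚ_[p] | ‖y‖ ≤ ‖t‖} (padicHaar p) ∧
        (∀ t' : ℚ_[p], ‖t'‖ = ‖t‖ → Iop p α φ t' = Iop p α φ t) ∧
        |Iop p α φ t| ≤ C₀ * μ' * ‖t‖ ^ (α - γ) := by
  have hI0 : 0 ≤ ∫ z in closedBall 0 1, |Iker p α 1 z| * ‖z‖ ^ (-γ) ∂(padicHaar p) :=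
    integral_nonneg fun z => by positivity
  refine ⟨|Icoef p α| * (∫ z in closedBall 0 1, |Iker p α 1 z| * ‖z‖ ^ (-γ) ∂(padicHaar p)) + 1,
    by positivity, ?_⟩
  intro μ' hμ φ hφ hb t ht
  have htp : 0 < ‖t‖ := norm_pos_iff.2 ht
  have hset : {y : ℚ_[p] | ‖y‖ ≤ ‖t‖} = closedBall 0 ‖t‖ := by
    ext y; simp [mem_closedBall_zero_iff]
  obtain ⟨hi, hint⟩ := scaled_G α γ hα hγ0 hγ t ht
  have hle : ∀ᵐ y ∂((padicHaar p).restrict (closedBall 0 ‖t‖)),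
      ‖Iker p α t y * φ y‖ ≤ μ' * (|Iker p α t y| * ‖y‖ ^ (-γ)) := by
    have e0 : ∀ᵐ z ∂(padicHaar p), z ≠ (0:ℚ_[p]) := by simp [ae_iff]
    filter_upwards [ae_restrict_of_ae e0] with y hy
    rw [norm_mul, Real.norm_eq_abs, Real.norm_eq_abs]
    calc |Iker p α t y| * |φ y| ≤ |Iker p α t y| * (μ' * ‖y‖ ^ (-γ)) := by
          gcongr; exact hb y hy
      _ = _ := by ring
  have hm : Measurable fun y => Iker p α t y * φ y := (measurable_Iker α t).mul (measurable_radial hφ)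
  refine ⟨?_, fun t' ht' => Iop_radial α φ hφ t t' ht ht', ?_⟩
  · rw [hset]
    exact Integrable.mono' (hi.const_mul μ') hm.aestronglyMeasurable hle
  · have h1 := norm_integral_le_of_norm_le (hi.const_mul μ') hle
    rw [integral_const_mul, hint, Real.norm_eq_abs] at h1
    unfold Iop
    rw [hset, abs_mul]
    have h2 : 0 ≤ μ' * ‖t‖ ^ (α - γ) := by positivity
    have h3 := mul_le_mul_of_nonneg_left h1 (abs_nonneg (Icoef p α))
    nlinarith
end

section
/- Let α > 0, let γ satisfy 0 < γ < min(1, α), let n ≥ 1 be an integer, let μ > 0, and let φ be a radial function with |φ(|t|_p)| ≤ μ |t|_p^{nα−(n+1)γ} for all t ≠ 0. Then for every t ≠ 0 the integral defining (I^α φ)(t) converges absolutely, (I^α φ)(t) depends only on |t|_p, and there exists a constant C_n > 0, depending only on p, α, γ and n, such that |(I^α φ)(|t|_p)| ≤ C_n μ |t|_p^{(n+1)(α−γ)} for all t ≠ 0. -/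
open MeasureTheory Metric

open scoped NNReal ENNReal Pointwise

instance padicHaar_isAddHaar (p : ℕ) [Fact p.Prime] : (padicHaar p).IsAddHaarMeasure := by
  unfold padicHaar; infer_instance

lemma padicHaar_ball (p : ℕ) [Fact p.Prime] : padicHaar p (closedBall 0 1) = 1 :=
  Measure.addHaarMeasure_self

lemma units_smul_closedBall (p : ℕ) [Fact p.Prime] (u : ℚ_[p]ˣ) (r : ℝ) :
    u • closedBall (0 : ℚ_[p]) r = closedBall 0 (‖(u : ℚ_[p])‖ * r) := by
  have hu : 0 < ‖(u : ℚ_[p])‖ := norm_pos_iff.2 u.ne_zero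
  ext x
  rw [Set.mem_smul_set_iff_inv_smul_mem]
  simp only [mem_closedBall, dist_zero_right, Units.smul_def, smul_eq_mul, norm_mul,
    Units.val_inv_eq_inv_val, norm_inv]
  rw [inv_mul_le_iff₀ hu]

lemma char_of_norm_one (p : ℕ) [Fact p.Prime] (u : ℚ_[p]ˣ) (hu : ‖(u : ℚ_[p])‖ = 1) :
    distribHaarChar ℚ_[p] u = 1 := by
  have h := distribHaarChar_mul (padicHaar p) u (closedBall (0 : ℚ_[p]) 1)
  rw [units_smul_closedBall, hu, one_mul, padicHaar_ball, mul_one] at h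
  exact_mod_cast h

noncomputable def pUnit (p : ℕ) [hp : Fact p.Prime] : ℚ_[p]ˣ :=
  Units.mk0 (p : ℚ_[p]) (by exact_mod_cast hp.out.ne_zero)

lemma pUnit_val (p : ℕ) [hp : Fact p.Prime] : ((pUnit p : ℚ_[p]ˣ) : ℚ_[p]) = p := rfl

lemma char_p (p : ℕ) [hp : Fact p.Prime] :
    distribHaarChar ℚ_[p] (pUnit p) = (p : ℝ≥0)⁻¹ := by
  have hB : (pUnit p) • closedBall (0 : ℚ_[p]) 1 = ball 0 1 := by
    rw [units_smul_closedBall, pUnit_val]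
    ext x
    simp only [mem_closedBall, mem_ball, dist_zero_right, mul_one, Padic.norm_p]
    have := Padic.norm_le_pow_iff_norm_lt_pow_add_one x (-1)
    simpa using this
  have hμB : padicHaar p (ball 0 1) = distribHaarChar ℚ_[p] (pUnit p) := by
    have h := distribHaarChar_mul (padicHaar p) (pUnit p) (closedBall (0 : ℚ_[p]) 1)
    rw [hB, padicHaar_ball, mul_one] at h
    exact h.symm
  have hU : closedBall (0 : ℚ_[p]) 1 = ⋃ i ∈ Finset.range p, ball (i : ℚ_[p]) 1 := by
    ext x
    rw [mem_closedBall, dist_zero_right]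
    simp only [Set.mem_iUnion, Finset.mem_range, mem_ball,
      dist_eq_norm, exists_prop]
    constructor
    · intro hx
      obtain ⟨X, rfl⟩ : ∃ X : ℤ_[p], (X : ℚ_[p]) = x := ⟨⟨x, hx⟩, rfl⟩
      obtain ⟨n, hn, h⟩ := PadicInt.exists_mem_range X
      refine ⟨n, hn, ?_⟩
      rw [IsLocalRing.mem_maximalIdeal, PadicInt.mem_nonunits, PadicInt.norm_def,
        PadicInt.coe_sub, PadicInt.coe_natCast] at h
      exact h
    · rintro ⟨i, -, hi⟩
      have h1 : ‖(i : ℚ_[p])‖ ≤ 1 := by simpa using Padic.norm_int_le_one (p := p) i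
      calc ‖x‖ = ‖(x - i) + i‖ := by ring_nf
        _ ≤ max ‖x - i‖ ‖(i : ℚ_[p])‖ := Padic.nonarchimedean _ _
        _ ≤ 1 := max_le hi.le h1
  have hd : Set.PairwiseDisjoint (↑(Finset.range p)) (fun i : ℕ => ball (i : ℚ_[p]) 1) := by
    intro i hi j hj hij
    refine Set.disjoint_left.2 fun x hx hx' => hij ?_
    simp only [mem_ball, dist_eq_norm] at hx hx'
    have : ‖(((i : ℤ) - (j : ℤ) : ℤ) : ℚ_[p])‖ < 1 := by
      calc ‖(((i : ℤ) - (j : ℤ) : ℤ) : ℚ_[p])‖ = ‖(x - j) + -(x - i)‖ := by push_cast; ring_nf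
        _ ≤ max ‖x - j‖ ‖-(x - i)‖ := Padic.nonarchimedean _ _
        _ < 1 := by rw [norm_neg]; exact max_lt hx' hx
    rw [Padic.norm_intCast_lt_one_iff] at this
    simp only [Finset.coe_range, Set.mem_Iio] at hi hj
    have h2 : (i : ℤ) - j = 0 := Int.eq_zero_of_abs_lt_dvd this (by rw [abs_lt]; omega)
    omega
  have h1 : (1 : ℝ≥0∞) = p * (distribHaarChar ℚ_[p] (pUnit p) : ℝ≥0∞) := by
    rw [← padicHaar_ball p, hU, measure_biUnion_finset hd (fun i _ => isOpen_ball.measurableSet)]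
    have : ∀ i : ℕ, padicHaar p (ball (i : ℚ_[p]) 1) = distribHaarChar ℚ_[p] (pUnit p) := by
      intro i
      rw [← hμB, Measure.addHaar_ball_center]
    simp [this]
  have h2 : (1 : ℝ≥0) = p * distribHaarChar ℚ_[p] (pUnit p) := by exact_mod_cast h1
  have : (p : ℝ≥0) ≠ 0 := by exact_mod_cast hp.out.ne_zero
  field_simp
  rw [mul_comm]; exact h2.symm

lemma char_eq (p : ℕ) [hp : Fact p.Prime] (u : ℚ_[p]ˣ) :
    distribHaarChar ℚ_[p] u = ‖(u : ℚ_[p])‖₊ := by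
  have hu := Padic.norm_eq_zpow_neg_valuation u.ne_zero
  set v := (u : ℚ_[p]).valuation
  have hp0 : (p : ℝ) ≠ 0 := by exact_mod_cast hp.out.ne_zero
  have h1 : ‖((u * (pUnit p) ^ (-v) : ℚ_[p]ˣ) : ℚ_[p])‖ = 1 := by
    rw [Units.val_mul, norm_mul, hu, Units.val_zpow_eq_zpow_val, pUnit_val, Padic.norm_p_zpow,
      neg_neg, ← zpow_add₀ hp0]
    simp
  have h2 := char_of_norm_one p _ h1
  have h3 : u = (u * (pUnit p) ^ (-v)) * (pUnit p) ^ v := by simp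
  rw [h3, map_mul, h2, map_zpow, char_p, one_mul]
  ext
  rw [← h3]
  push_cast
  rw [hu, inv_zpow, zpow_neg]

lemma haar_smul (p : ℕ) [hp : Fact p.Prime] (t : ℚ_[p]) (ht : t ≠ 0) :
    Measure.map (fun z => t * z) (padicHaar p) = (ENNReal.ofReal ‖t‖)⁻¹ • padicHaar p := by
  ext s hs
  rw [Measure.map_apply (by fun_prop) hs]
  have h := distribHaarChar_mul (padicHaar p) (Units.mk0 t ht)⁻¹ s
  rw [char_eq] at h
  have : (Units.mk0 t ht)⁻¹ • s = (fun z => t * z) ⁻¹' s := by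
    ext x
    rw [Set.mem_smul_set_iff_inv_smul_mem, inv_inv]
    simp [Units.smul_def]
  rw [← this, ← h]
  simp only [Measure.smul_apply, smul_eq_mul]
  congr 1
  rw [ofReal_norm]
  simp [enorm_eq_nnnorm, ht]

lemma haar_closedBall (p : ℕ) [hp : Fact p.Prime] (k : ℕ) :
    padicHaar p (closedBall 0 ((p : ℝ) ^ (-(k : ℤ)))) = ENNReal.ofReal ((p : ℝ) ^ (-(k : ℤ))) := by
  have h := distribHaarChar_mul (padicHaar p) ((pUnit p) ^ k) (closedBall (0 : ℚ_[p]) 1)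
  rw [units_smul_closedBall, padicHaar_ball, mul_one, mul_one, char_eq, Units.val_pow_eq_pow_val,
    pUnit_val, Padic.norm_p_pow] at h
  rw [← h, ← Padic.norm_p_pow, ofReal_norm, enorm_eq_nnnorm]

lemma haar_singleton (p : ℕ) [hp : Fact p.Prime] (x : ℚ_[p]) : padicHaar p {x} = 0 :=
  measure_singleton x

lemma int_rpow (p : ℕ) [hp : Fact p.Prime] (s : ℝ) (hs : -1 < s) :
    IntegrableOn (fun y : ℚ_[p] => ‖y‖ ^ s) (closedBall 0 1) (padicHaar p) := by
  have hp1 : (1 : ℝ) < p := by exact_mod_cast hp.out.one_lt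
  have hp0 : (0 : ℝ) < p := by linarith
  have hsub : closedBall (0 : ℚ_[p]) 1 ⊆ {0} ∪ ⋃ k : ℕ, sphere 0 ((p : ℝ) ^ (-(k : ℤ))) := by
    intro x hx
    rw [mem_closedBall, dist_zero_right] at hx
    by_cases h0 : x = 0
    · left; simpa using h0
    · right
      rw [Set.mem_iUnion]
      have hv : 0 ≤ x.valuation := by
        by_contra hv
        rw [Padic.norm_eq_zpow_neg_valuation h0, zpow_le_one_iff_right₀ hp1] at hx
        omega
      refine ⟨x.valuation.toNat, ?_⟩
      rw [mem_sphere, dist_zero_right, Int.toNat_of_nonneg hv]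
      exact Padic.norm_eq_zpow_neg_valuation h0
  refine IntegrableOn.mono_set ?_ hsub
  refine IntegrableOn.union (by simp) ?_
  have hm : ∀ k : ℕ, MeasurableSet (sphere (0 : ℚ_[p]) ((p : ℝ) ^ (-(k : ℤ)))) :=
    fun k => isClosed_sphere.measurableSet
  have hfin : ∀ k : ℕ, padicHaar p (sphere (0 : ℚ_[p]) ((p : ℝ) ^ (-(k : ℤ)))) ≤
      ENNReal.ofReal ((p : ℝ) ^ (-(k : ℤ))) := fun k => by
    rw [← haar_closedBall]; exact measure_mono sphere_subset_closedBall
  have hc : ∀ k : ℕ, Set.EqOn (fun y : ℚ_[p] => ‖y‖ ^ s)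
      (fun _ => ((p : ℝ) ^ (-(k : ℤ))) ^ s) (sphere (0 : ℚ_[p]) ((p : ℝ) ^ (-(k : ℤ)))) := by
    intro k y hy
    rw [mem_sphere, dist_zero_right] at hy
    simp [hy]
  refine integrableOn_iUnion_of_summable_integral_norm (fun k => ?_) ?_
  · rw [integrableOn_congr_fun (hc k) (hm k)]
    exact integrableOn_const (ne_top_of_le_ne_top ENNReal.ofReal_ne_top (hfin k))
  · have hval : ∀ k : ℕ, ((p : ℝ) ^ (-(k : ℤ))) * ((p : ℝ) ^ (-(k : ℤ))) ^ s
        = ((p : ℝ) ^ (-(1 + s))) ^ k := by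
      intro k
      rw [← Real.rpow_intCast, ← Real.rpow_mul hp0.le, ← Real.rpow_add hp0,
        ← Real.rpow_natCast, ← Real.rpow_mul hp0.le]
      push_cast
      congr 1; ring
    refine Summable.of_nonneg_of_le (fun k => integral_nonneg fun _ => norm_nonneg _) (fun k => ?_)
      (summable_geometric_of_lt_one (r := (p : ℝ) ^ (-(1 + s))) (by positivity)
        (Real.rpow_lt_one_of_one_lt_of_neg hp1 (by linarith)))
    rw [← hval k, setIntegral_congr_fun (g := fun _ => ((p : ℝ) ^ (-(k : ℤ))) ^ s) (hm k)]
    · rw [setIntegral_const, smul_eq_mul]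
      gcongr
      exact ENNReal.toReal_le_of_le_ofReal (by positivity) (hfin k)
    · intro y hy
      have := hc k hy
      simp only at this ⊢
      rw [this, Real.norm_of_nonneg (by positivity)]

lemma int_rpow_shift (p : ℕ) [hp : Fact p.Prime] (s : ℝ) (hs : -1 < s) :
    IntegrableOn (fun y : ℚ_[p] => ‖1 - y‖ ^ s) (closedBall 0 1) (padicHaar p) := by
  have h := int_rpow p s hs
  have hpre : (fun y : ℚ_[p] => 1 - y) ⁻¹' (closedBall 0 1) = closedBall 0 1 := by
    have key : ∀ y : ℚ_[p], ‖y‖ ≤ 1 → ‖1 - y‖ ≤ 1 := fun y hy => by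
      calc ‖1 - y‖ = ‖1 + -y‖ := by ring_nf
        _ ≤ max ‖(1 : ℚ_[p])‖ ‖-y‖ := Padic.nonarchimedean _ _
        _ ≤ 1 := by rw [norm_neg, norm_one]; exact max_le le_rfl hy
    ext y
    rw [Set.mem_preimage, mem_closedBall, mem_closedBall, dist_zero_right, dist_zero_right]
    refine ⟨fun h => ?_, key y⟩
    simpa using key _ h
  have hmp : MeasurePreserving (fun y : ℚ_[p] => 1 - y) (padicHaar p) (padicHaar p) :=
    Measure.measurePreserving_sub_left _ _
  have := (hmp.integrableOn_comp_preimage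
    (Homeomorph.subLeft (1 : ℚ_[p])).measurableEmbedding).2 h
  rw [hpre] at this
  exact this

lemma radial_measurable (p : ℕ) [hp : Fact p.Prime] (φ : ℚ_[p] → ℝ) (h : Radial p φ) :
    Measurable φ := by
  intro s _
  have hcount : (Set.range (fun x : ℚ_[p] => ‖x‖)).Countable := by
    refine ((Set.countable_range (fun k : ℤ => (p : ℝ) ^ k)).insert 0).mono ?_
    rintro _ ⟨x, rfl⟩
    by_cases hx : x = 0
    · left; simp [hx]
    · right; exact ⟨_, (Padic.norm_eq_zpow_neg_valuation hx).symm⟩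
  have : φ ⁻¹' s = (fun x : ℚ_[p] => ‖x‖) ⁻¹' ((fun x : ℚ_[p] => ‖x‖) '' (φ ⁻¹' s)) := by
    refine Set.Subset.antisymm (Set.subset_preimage_image _ _) ?_
    rintro x ⟨y, hy, hxy⟩
    simp only [Set.mem_preimage] at hy ⊢
    rwa [h x y hxy.symm]
  rw [this]
  exact measurable_norm (hcount.mono (Set.image_subset_range _ _)).measurableSet

lemma norm_one_sub_le (p : ℕ) [hp : Fact p.Prime] (y : ℚ_[p]) (hy : ‖y‖ ≤ 1) : ‖1 - y‖ ≤ 1 := by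
  calc ‖1 - y‖ = ‖1 + -y‖ := by ring_nf
    _ ≤ max ‖(1 : ℚ_[p])‖ ‖-y‖ := Padic.nonarchimedean _ _
    _ ≤ 1 := by rw [norm_neg, norm_one]; exact max_le le_rfl hy

lemma ker_bound (p : ℕ) [hp : Fact p.Prime] (α δ : ℝ) (hδ0 : 0 < δ) (hδ : 1 - α ≤ δ)
    (z : ℚ_[p]) (hz0 : z ≠ 0) (hz1 : z ≠ 1) (hz : ‖z‖ ≤ 1) :
    |Iker p α 1 z| ≤ (1 + 1 / δ) * (‖1 - z‖ ^ (-δ) + ‖z‖ ^ (-δ)) := by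
  have ha0 : 0 < ‖1 - z‖ := norm_pos_iff.2 (sub_ne_zero.2 hz1.symm)
  have hb0 : 0 < ‖z‖ := norm_pos_iff.2 hz0
  have ha1 := norm_one_sub_le p z hz
  unfold Iker
  generalize ‖1 - z‖ = a at *
  have hpow : ∀ r : ℝ, 0 < r → r ≤ 1 → |r ^ (α - 1)| ≤ r ^ (-δ) := fun r h0 h1 => by
    rw [abs_of_nonneg (by positivity)]
    exact Real.rpow_le_rpow_of_exponent_ge h0 h1 (by linarith)
  have hlog : ∀ r : ℝ, 0 < r → r ≤ 1 → |Real.log r| ≤ 1 / δ * r ^ (-δ) := fun r h0 h1 => by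
    have h := Real.abs_log_mul_self_rpow_lt r δ h0 h1 hδ0
    have hr : 0 < r ^ δ := Real.rpow_pos_of_pos h0 _
    rw [abs_mul, abs_of_pos hr] at h
    rw [Real.rpow_neg h0.le, ← div_eq_mul_inv, le_div_iff₀ hr]
    exact h.le
  have hA : 0 ≤ a ^ (-δ) := by positivity
  have hB : 0 ≤ ‖z‖ ^ (-δ) := by positivity
  have hd : 0 < 1 / δ := by positivity
  have hmul : 0 ≤ 1 / δ * (a ^ (-δ) + ‖z‖ ^ (-δ)) := by positivity
  split_ifs
  · have h1 := hlog _ ha0 ha1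
    have h2 := hlog _ hb0 hz
    have h3 := abs_sub (Real.log a) (Real.log ‖z‖)
    nlinarith
  · have h1 := hpow _ ha0 ha1
    have h2 := hpow _ hb0 hz
    have h3 := abs_sub (a ^ (α - 1)) (‖z‖ ^ (α - 1))
    nlinarith

lemma K_bound (p : ℕ) [hp : Fact p.Prime] (α β δ : ℝ) (hδ0 : 0 < δ) (hδ : 1 - α ≤ δ)
    (z : ℚ_[p]) (hz0 : z ≠ 0) (hz1 : z ≠ 1) (hz : ‖z‖ ≤ 1) :
    |Iker p α 1 z| * ‖z‖ ^ β ≤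
      (1 + 1 / δ) * (‖z‖ ^ β + ‖z‖ ^ (β - δ) + ‖1 - z‖ ^ (-δ)) := by
  have h := ker_bound p α δ hδ0 hδ z hz0 hz1 hz
  have hb0 : 0 < ‖z‖ := norm_pos_iff.2 hz0
  have hd : 0 < 1 + 1 / δ := by positivity
  rcases hz.lt_or_eq with hlt | heq
  · have h1 : ‖1 - z‖ = 1 := by
      have := IsUltrametricDist.norm_add_eq_max_of_norm_ne_norm (x := (1 : ℚ_[p])) (y := -z)
        (by rw [norm_neg, norm_one]; exact hlt.ne')
      rw [norm_neg, norm_one, max_eq_left hz] at this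
      rwa [sub_eq_add_neg]
    rw [h1, Real.one_rpow] at h ⊢
    calc _ ≤ (1 + 1 / δ) * (1 + ‖z‖ ^ (-δ)) * ‖z‖ ^ β := by gcongr
      _ = (1 + 1 / δ) * (‖z‖ ^ β + ‖z‖ ^ (β - δ)) := by
        rw [sub_eq_add_neg, Real.rpow_add hb0]; ring
      _ ≤ _ := mul_le_mul_of_nonneg_left (by linarith) hd.le
  · rw [heq] at h ⊢
    simp only [Real.one_rpow, mul_one] at h ⊢
    exact h.trans (mul_le_mul_of_nonneg_left (by linarith) hd.le)

lemma iker_measurable (p : ℕ) [hp : Fact p.Prime] (α : ℝ) (t : ℚ_[p]) :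
    Measurable (fun z => Iker p α t z) := by
  unfold Iker
  split_ifs <;> fun_prop

lemma K_int (p : ℕ) [hp : Fact p.Prime] (α β δ : ℝ) (hδ0 : 0 < δ) (hδ : 1 - α ≤ δ) (hδ1 : δ < 1)
    (hβδ : δ < 1 + β) :
    IntegrableOn (fun z : ℚ_[p] => |Iker p α 1 z| * ‖z‖ ^ β) (closedBall 0 1) (padicHaar p) := by
  have h1 := int_rpow p β (by linarith)
  have h2 := int_rpow p (β - δ) (by linarith)
  have h3 := int_rpow_shift p (-δ) (by linarith)
  refine Integrable.mono' (((h1.add h2).add h3).const_mul (1 + 1 / δ)) ?_ ?_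
  · have := iker_measurable p α 1
    exact Measurable.aestronglyMeasurable (by fun_prop)
  · have e0 : ∀ᵐ z ∂(padicHaar p).restrict (closedBall 0 1), z ≠ 0 :=
      ae_restrict_of_ae (by simp [ae_iff])
    have e1 : ∀ᵐ z ∂(padicHaar p).restrict (closedBall 0 1), z ≠ 1 :=
      ae_restrict_of_ae (by simp [ae_iff])
    filter_upwards [e0, e1, ae_restrict_mem isClosed_closedBall.measurableSet] with z h0 h1 hz
    rw [mem_closedBall, dist_zero_right] at hz
    rw [Real.norm_of_nonneg (by positivity)]
    exact K_bound p α β δ hδ0 hδ z h0 h1 hz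

lemma iker_scale (p : ℕ) [hp : Fact p.Prime] (α : ℝ) (t z : ℚ_[p]) (ht : t ≠ 0) (h0 : z ≠ 0)
    (h1 : z ≠ 1) : Iker p α t (t * z) = ‖t‖ ^ (α - 1) * Iker p α 1 z := by
  have e : t - t * z = t * (1 - z) := by ring
  have h1' : ‖1 - z‖ ≠ 0 := norm_ne_zero_iff.2 (sub_ne_zero.2 h1.symm)
  unfold Iker
  rw [e, norm_mul, norm_mul]
  split_ifs with h
  · rw [Real.log_mul (norm_ne_zero_iff.2 ht) h1',
      Real.log_mul (norm_ne_zero_iff.2 ht) (norm_ne_zero_iff.2 h0), h]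
    simp
  · rw [Real.mul_rpow (norm_nonneg _) (norm_nonneg _), Real.mul_rpow (norm_nonneg _) (norm_nonneg _)]
    ring

lemma pre_ball (p : ℕ) [hp : Fact p.Prime] (t : ℚ_[p]) (ht : t ≠ 0) :
    (fun z => t * z) ⁻¹' {y : ℚ_[p] | ‖y‖ ≤ ‖t‖} = closedBall 0 1 := by
  ext z
  have : 0 < ‖t‖ := norm_pos_iff.2 ht
  simp [this]

lemma scaled_ae (p : ℕ) [hp : Fact p.Prime] (α : ℝ) (t : ℚ_[p]) (ht : t ≠ 0) (φ : ℚ_[p] → ℝ) :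
    (fun z => Iker p α t (t * z) * φ (t * z)) =ᵐ[(padicHaar p).restrict (closedBall 0 1)]
      fun z => ‖t‖ ^ (α - 1) * (Iker p α 1 z * φ (t * z)) := by
  have e0 : ∀ᵐ z ∂(padicHaar p).restrict (closedBall 0 1), z ≠ 0 :=
    ae_restrict_of_ae (by simp [ae_iff])
  have e1 : ∀ᵐ z ∂(padicHaar p).restrict (closedBall 0 1), z ≠ 1 :=
    ae_restrict_of_ae (by simp [ae_iff])
  filter_upwards [e0, e1] with z h0 h1
  rw [iker_scale p α t z ht h0 h1]; ring

lemma mul_emb (p : ℕ) [hp : Fact p.Prime] (t : ℚ_[p]) (ht : t ≠ 0) :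
    MeasurableEmbedding (fun z => t * z) := (Homeomorph.mulLeft₀ t ht).measurableEmbedding

lemma intOn_scale (p : ℕ) [hp : Fact p.Prime] (t : ℚ_[p]) (ht : t ≠ 0) (F : ℚ_[p] → ℝ)
    (h : IntegrableOn (fun z => F (t * z)) (closedBall 0 1) (padicHaar p)) :
    IntegrableOn F {y : ℚ_[p] | ‖y‖ ≤ ‖t‖} (padicHaar p) := by
  have h0 : 0 < ‖t‖ := norm_pos_iff.2 ht
  rw [← pre_ball p t ht] at h
  have h2 := ((mul_emb p t ht).integrableOn_map_iff (μ := padicHaar p) (f := F)).2 h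
  rw [haar_smul p t ht, IntegrableOn, Measure.restrict_smul, integrable_smul_measure] at h2
  · exact h2
  · simp
  · simp [ht]

lemma integral_scale_s9 (p : ℕ) [hp : Fact p.Prime] (t : ℚ_[p]) (ht : t ≠ 0) (F : ℚ_[p] → ℝ) :
    ∫ y in {y : ℚ_[p] | ‖y‖ ≤ ‖t‖}, F y ∂(padicHaar p) =
      ‖t‖ * ∫ z in closedBall 0 1, F (t * z) ∂(padicHaar p) := by
  have h0 : 0 < ‖t‖ := norm_pos_iff.2 ht
  have h := (mul_emb p t ht).setIntegral_map (μ := padicHaar p) F {y : ℚ_[p] | ‖y‖ ≤ ‖t‖}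
  rw [haar_smul p t ht, Measure.restrict_smul, integral_smul_measure, pre_ball p t ht] at h
  rw [← h, ENNReal.toReal_inv, ENNReal.toReal_ofReal h0.le, smul_eq_mul, mul_inv_cancel_left₀ h0.ne']

lemma Iop_scale (p : ℕ) [hp : Fact p.Prime] (α : ℝ) (t : ℚ_[p]) (ht : t ≠ 0) (φ : ℚ_[p] → ℝ) :
    Iop p α φ t = Icoef p α * (‖t‖ ^ α *
      ∫ z in closedBall 0 1, Iker p α 1 z * φ (t * z) ∂(padicHaar p)) := by
  have h0 : 0 < ‖t‖ := norm_pos_iff.2 ht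
  unfold Iop
  have e : ‖t‖ ^ α = ‖t‖ * ‖t‖ ^ (α - 1) := by
    rw [Real.rpow_sub_one h0.ne']; field_simp
  rw [integral_scale_s9 p t ht, integral_congr_ae (scaled_ae p α t ht φ), integral_const_mul, e,
    mul_assoc]

/-- bound for `I^α φ` when `|φ(t)| ≤ μ |t|^{nα-(n+1)γ}`. -/
theorem Iop_bound_step (p : ℕ) [Fact p.Prime] (α γ : ℝ) (hα : 0 < α) (hγ0 : 0 < γ)
    (hγ : γ < min 1 α) (n : ℕ) (hn : 1 ≤ n) :
    ∃ C : ℝ, 0 < C ∧ ∀ μ' : ℝ, 0 < μ' → ∀ φ : ℚ_[p] → ℝ, Radial p φ →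
      (∀ t : ℚ_[p], t ≠ 0 → |φ t| ≤ μ' * ‖t‖ ^ ((n : ℝ) * α - ((n : ℝ) + 1) * γ)) →
      ∀ t : ℚ_[p], t ≠ 0 →
        IntegrableOn (fun y => Iker p α t y * φ y) {y : ℚ_[p] | ‖y‖ ≤ ‖t‖} (padicHaar p) ∧
        (∀ t' : ℚ_[p], ‖t'‖ = ‖t‖ → Iop p α φ t' = Iop p α φ t) ∧
        |Iop p α φ t| ≤ C * μ' * ‖t‖ ^ (((n : ℝ) + 1) * (α - γ)) := by
  set β : ℝ := (n : ℝ) * α - ((n : ℝ) + 1) * γ with hβ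
  have hγ1 : γ < 1 := hγ.trans_le (min_le_left _ _)
  have hγα : γ < α := hγ.trans_le (min_le_right _ _)
  have hsum : α + β = ((n : ℝ) + 1) * (α - γ) := by rw [hβ]; ring
  have hn0 : (0 : ℝ) ≤ n := by positivity
  have hβ1 : 0 < 1 + β := by
    have : 0 ≤ (n : ℝ) * (α - γ) := mul_nonneg hn0 (by linarith)
    have : β = (n : ℝ) * (α - γ) - γ := by rw [hβ]; ring
    linarith
  have hαβ : 0 < α + β := by
    rw [hsum]; exact mul_pos (by linarith) (by linarith)
  obtain ⟨δ, hδl, hδu⟩ : ∃ δ, max 0 (1 - α) < δ ∧ δ < min 1 (1 + β) :=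
    exists_between (max_lt (lt_min one_pos hβ1) (lt_min (by linarith) (by linarith)))
  rw [max_lt_iff] at hδl
  rw [lt_min_iff] at hδu
  have hK := K_int p α β δ hδl.1 hδl.2.le hδu.1 hδu.2
  set J := ∫ z in closedBall 0 1, |Iker p α 1 z| * ‖z‖ ^ β ∂(padicHaar p) with hJ
  have hJ0 : 0 ≤ J := integral_nonneg fun z => by positivity
  refine ⟨|Icoef p α| * J + 1, by positivity, fun μ' hμ φ hφ hb t ht => ?_⟩
  have ht0 : 0 < ‖t‖ := norm_pos_iff.2 ht
  have hφm := radial_measurable p φ hφ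
  have hkm := iker_measurable p α 1
  have hdom : ∀ᵐ z ∂(padicHaar p).restrict (closedBall 0 1),
      ‖Iker p α 1 z * φ (t * z)‖ ≤ (μ' * ‖t‖ ^ β) * (|Iker p α 1 z| * ‖z‖ ^ β) := by
    have e0 : ∀ᵐ z ∂(padicHaar p).restrict (closedBall 0 1), z ≠ 0 :=
      ae_restrict_of_ae (by simp [ae_iff])
    filter_upwards [e0] with z h0
    have h := hb (t * z) (mul_ne_zero ht h0)
    rw [norm_mul, Real.mul_rpow (norm_nonneg _) (norm_nonneg _)] at h
    rw [norm_mul, Real.norm_eq_abs, Real.norm_eq_abs]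
    calc _ ≤ |Iker p α 1 z| * (μ' * (‖t‖ ^ β * ‖z‖ ^ β)) := by gcongr
      _ = _ := by ring
  have hKc := hK.const_mul (μ' * ‖t‖ ^ β)
  have hint : IntegrableOn (fun z => Iker p α 1 z * φ (t * z)) (closedBall 0 1) (padicHaar p) :=
    Integrable.mono' hKc (Measurable.aestronglyMeasurable (by fun_prop)) hdom
  refine ⟨?_, ?_, ?_⟩
  · refine intOn_scale p t ht _ ?_
    exact (hint.const_mul (‖t‖ ^ (α - 1))).congr (scaled_ae p α t ht φ).symm
  · intro t' ht'
    have ht'0 : t' ≠ 0 := norm_pos_iff.1 (by rw [ht']; exact ht0)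
    rw [Iop_scale p α t ht, Iop_scale p α t' ht'0, ht']
    have : ∀ z, φ (t' * z) = φ (t * z) := fun z => hφ _ _ (by rw [norm_mul, norm_mul, ht'])
    simp only [this]
  · have h1 := norm_integral_le_of_norm_le hKc hdom
    rw [integral_const_mul, ← hJ, Real.norm_eq_abs] at h1
    rw [Iop_scale p α t ht, abs_mul, abs_mul, abs_of_nonneg (by positivity : 0 ≤ ‖t‖ ^ α),
      ← hsum, Real.rpow_add ht0]
    calc _ ≤ |Icoef p α| * (‖t‖ ^ α * (μ' * ‖t‖ ^ β * J)) := by gcongr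
      _ = |Icoef p α| * J * μ' * (‖t‖ ^ α * ‖t‖ ^ β) := by ring
      _ ≤ _ := by
        gcongr
        linarith
end
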